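/- If L ⊆ L' are λ-admissible chains of order ideals of P that differ by exactly r ideals, then dim L' = dim L + r. In particular, if dim L' = dim L + 1, then L' is obtained from L by a single I_k-refinement (insertion of one ideal). -/

import Mathlib

open Classical

variable {P : Type} [Fintype P] [DecidableEq P] [PartialOrder P]

/-- An order ideal (downward-closed subset) of a finite poset. -/
def IsIdeal (I : Finset P) : Prop := ∀ x ∈ I, ∀ y, y ≤ x → y ∈ I

/-- A chain of order ideals of `P` containing `∅` and `P`, viewed as the finite set of
its members. -/
structure IdealChain (P : Type) [Fintype P] [DecidableEq P] [PartialOrder P] where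
  ideals : Finset (Finset P)
  isIdeal : ∀ I ∈ ideals, IsIdeal I
  chain : ∀ I ∈ ideals, ∀ J ∈ ideals, I ⊆ J ∨ J ⊆ I
  empty_mem : ∅ ∈ ideals
  univ_mem : Finset.univ ∈ ideals

/-- `I` and `J` are consecutive members of the chain `L`. -/
def Consec (L : IdealChain P) (I J : Finset P) : Prop :=
  I ∈ L.ideals ∧ J ∈ L.ideals ∧ I ⊂ J ∧ ∀ K ∈ L.ideals, ¬ (I ⊂ K ∧ K ⊂ J)

/-- λ-admissibility of a chain of ideals: on each consecutive difference the marked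
elements have a common λ-value, and these values strictly increase along the chain. -/
def Admissible (Pstar : Finset P) (lam : P → ℝ) (L : IdealChain P) : Prop :=
  (∀ I J, Consec L I J → ∀ a ∈ (J \ I) ∩ Pstar, ∀ b ∈ (J \ I) ∩ Pstar, lam a = lam b) ∧
  (∀ I J I' J', Consec L I J → Consec L I' J' → J ⊆ I' →
    ∀ a ∈ (J \ I) ∩ Pstar, ∀ b ∈ (J' \ I') ∩ Pstar, lam a < lam b)

/-- The set `F_L ⊆ ℝ^P`: functions extending `lam`, constant on consecutive differences
of `L`, with weakly increasing values along the chain. -/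
def FL (Pstar : Finset P) (lam : P → ℝ) (L : IdealChain P) : Set (P → ℝ) :=
  {x | (∀ a ∈ Pstar, x a = lam a) ∧
       (∀ I J, Consec L I J → ∀ p ∈ J \ I, ∀ q ∈ J \ I, x p = x q) ∧
       (∀ I J I' J', Consec L I J → Consec L I' J' → J ⊆ I' →
         ∀ p ∈ J \ I, ∀ q ∈ J' \ I', x p ≤ x q)}

/-- The marked order polytope `O(P, λ)`. -/
def MOP (Pstar : Finset P) (lam : P → ℝ) : Set (P → ℝ) :=
  {x | (∀ p q : P, p ≤ q → x p ≤ x q) ∧ ∀ a ∈ Pstar, x a = lam a}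

/-- `p` is an extremal (minimal or maximal) element of the poset. -/
def IsExtremalElt (p : P) : Prop := (∀ q, q ≤ p → q = p) ∨ (∀ q, p ≤ q → q = p)

/-- `lam` is order-preserving on the marked elements. -/
def LamMono (Pstar : Finset P) (lam : P → ℝ) : Prop :=
  ∀ a ∈ Pstar, ∀ b ∈ Pstar, a ≤ b → lam a ≤ lam b

/-- The dimension of a chain: the number of consecutive differences disjoint
from the marked set. -/
noncomputable def chainDim (Pstar : Finset P) (L : IdealChain P) : ℕ :=
  ((L.ideals ×ˢ L.ideals).filter
    (fun IJ => Consec L IJ.1 IJ.2 ∧ (IJ.2 \ IJ.1) ∩ Pstar = ∅)).card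

lemma Consec.subset_of_ssubset {L : IdealChain P} {I J I' J' : Finset P}
    (h : Consec L I J) (h' : Consec L I' J') (hJ : J ⊂ J') : J ⊆ I' := by
  rcases L.chain J h.2.1 I' h'.1 with hs | hs
  · exact hs
  · by_contra hn
    exact h'.2.2.2 J h.2.1 ⟨⟨hs, hn⟩, hJ⟩

lemma Consec.left_unique {L : IdealChain P} {I I' J : Finset P}
    (h : Consec L I J) (h' : Consec L I' J) : I = I' := by
  by_contra hne
  rcases L.chain I h.1 I' h'.1 with hs | hs
  · exact h.2.2.2 I' h'.1 ⟨hs.ssubset_of_ne hne, h'.2.2.1⟩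
  · exact h'.2.2.2 I h.1 ⟨hs.ssubset_of_ne (Ne.symm hne), h.2.2.1⟩

lemma Consec.trichotomy {L : IdealChain P} {I J I' J' : Finset P}
    (h : Consec L I J) (h' : Consec L I' J') : J ⊆ I' ∨ (I = I' ∧ J = J') ∨ J' ⊆ I := by
  by_cases hJ : J = J'
  · subst hJ
    exact Or.inr (Or.inl ⟨h.left_unique h', rfl⟩)
  · rcases L.chain J h.2.1 J' h'.2.1 with hs | hs
    · exact Or.inl (h.subset_of_ssubset h' (hs.ssubset_of_ne hJ))
    · exact Or.inr (Or.inr (h'.subset_of_ssubset h (hs.ssubset_of_ne (Ne.symm hJ))))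

lemma IdealChain.exists_consec_left (L : IdealChain P) {J : Finset P}
    (hJ : J ∈ L.ideals) (hne : J ≠ ∅) : ∃ I, Consec L I J := by
  obtain ⟨I, hI⟩ := (L.ideals.filter (· ⊂ J)).exists_maximal
    ⟨∅, Finset.mem_filter.2 ⟨L.empty_mem, (Finset.empty_subset J).ssubset_of_ne hne.symm⟩⟩
  obtain ⟨hIL, hIJ⟩ := Finset.mem_filter.1 hI.prop
  exact ⟨I, hIL, hJ, hIJ, fun K hK hb =>
    hI.not_gt (Finset.mem_filter.2 ⟨hK, hb.2⟩) hb.1⟩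

lemma IdealChain.exists_consec_mem_sdiff (L : IdealChain P) (p : P) :
    ∃ I J, Consec L I J ∧ p ∈ J \ I := by
  obtain ⟨J, hJ⟩ := (L.ideals.filter (p ∈ ·)).exists_minimal
    ⟨Finset.univ, Finset.mem_filter.2 ⟨L.univ_mem, Finset.mem_univ p⟩⟩
  obtain ⟨hJL, hpJ⟩ := Finset.mem_filter.1 hJ.prop
  obtain ⟨I, hI⟩ := L.exists_consec_left hJL (Finset.ne_empty_of_mem hpJ)
  exact ⟨I, J, hI, Finset.mem_sdiff.2 ⟨hpJ, fun hpI =>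
    hJ.not_lt (Finset.mem_filter.2 ⟨hI.1, hpI⟩) hI.2.2.1⟩⟩

lemma IdealChain.card_consec_add_one (L : IdealChain P) :
    ((L.ideals ×ˢ L.ideals).filter (fun IJ => Consec L IJ.1 IJ.2)).card + 1
      = L.ideals.card := by
  rw [← Finset.card_erase_add_one L.empty_mem, Nat.add_right_cancel_iff]
  refine Finset.card_bij (fun IJ _ => IJ.2) ?_ ?_ ?_
  · rintro ⟨I, J⟩ h
    have hc := (Finset.mem_filter.1 h).2
    exact Finset.mem_erase.2
      ⟨((Finset.empty_subset I).trans_ssubset hc.2.2.1).ne', hc.2.1⟩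
  · rintro ⟨I, J⟩ h ⟨I', J'⟩ h' (rfl : J = J')
    exact Prod.ext ((Finset.mem_filter.1 h).2.left_unique (Finset.mem_filter.1 h').2) rfl
  · intro J hJ
    obtain ⟨hne, hJL⟩ := Finset.mem_erase.1 hJ
    obtain ⟨I, hI⟩ := L.exists_consec_left hJL hne
    exact ⟨(I, J), Finset.mem_filter.2 ⟨Finset.mk_mem_product hI.1 hJL, hI⟩, rfl⟩

/-- In an admissible chain, the consecutive differences meeting the marked set correspond
bijectively to the values of the marking. -/
lemma Admissible.card_marked_consec {Pstar : Finset P} {lam : P → ℝ} {L : IdealChain P}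
    (hL : Admissible Pstar lam L) :
    ((L.ideals ×ˢ L.ideals).filter
      (fun IJ => Consec L IJ.1 IJ.2 ∧ ¬ (IJ.2 \ IJ.1) ∩ Pstar = ∅)).card
      = (Pstar.image lam).card := by
  have key : ∀ IJ ∈ (L.ideals ×ˢ L.ideals).filter
      (fun IJ => Consec L IJ.1 IJ.2 ∧ ¬ (IJ.2 \ IJ.1) ∩ Pstar = ∅),
      Consec L IJ.1 IJ.2 ∧ ∃ a, a ∈ (IJ.2 \ IJ.1) ∩ Pstar := fun IJ h =>
    ⟨(Finset.mem_filter.1 h).2.1, Finset.nonempty_iff_ne_empty.2 (Finset.mem_filter.1 h).2.2⟩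
  refine Finset.card_bij (fun IJ h => lam (key IJ h).2.choose) ?_ ?_ ?_
  · intro IJ h
    exact Finset.mem_image_of_mem lam (Finset.mem_inter.1 (key IJ h).2.choose_spec).2
  · intro IJ h IJ' h' heq
    have ha := (key IJ h).2.choose_spec
    have ha' := (key IJ' h').2.choose_spec
    rcases (key IJ h).1.trichotomy (key IJ' h').1 with hs | ⟨h₁, h₂⟩ | hs
    · exact absurd heq (hL.2 _ _ _ _ (key IJ h).1 (key IJ' h').1 hs _ ha _ ha').ne
    · exact Prod.ext h₁ h₂
    · exact absurd heq (hL.2 _ _ _ _ (key IJ' h').1 (key IJ h).1 hs _ ha' _ ha).ne'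
  · intro v hv
    obtain ⟨p, hp, rfl⟩ := Finset.mem_image.1 hv
    obtain ⟨I, J, hc, hpd⟩ := L.exists_consec_mem_sdiff p
    have hpm := Finset.mem_inter.2 ⟨hpd, hp⟩
    have hm : (I, J) ∈ (L.ideals ×ˢ L.ideals).filter
        (fun IJ => Consec L IJ.1 IJ.2 ∧ ¬ (IJ.2 \ IJ.1) ∩ Pstar = ∅) :=
      Finset.mem_filter.2 ⟨Finset.mk_mem_product hc.1 hc.2.1, hc, Finset.ne_empty_of_mem hpm⟩
    exact ⟨(I, J), hm, hL.1 I J hc _ (key _ hm).2.choose_spec _ hpm⟩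

lemma Admissible.chainDim_add_card_image {Pstar : Finset P} {lam : P → ℝ} {L : IdealChain P}
    (hL : Admissible Pstar lam L) :
    chainDim Pstar L + (Pstar.image lam).card + 1 = L.ideals.card := by
  rw [← L.card_consec_add_one, ← hL.card_marked_consec, chainDim, ← Finset.filter_filter,
    ← Finset.filter_filter, Finset.card_filter_add_card_filter_not]

/-- If λ-admissible chains `L ⊆ L'` differ by exactly `r` ideals then
`dim L' = dim L + r`; in particular if `r = 1` then `L'` is obtained from `L` by a
single refinement (insertion of one ideal). -/
theorem dim_add_of_subchain (Pstar : Finset P) (lam : P → ℝ)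
    (hext : ∀ p : P, IsExtremalElt p → p ∈ Pstar) (hlam : LamMono Pstar lam)
    (L L' : IdealChain P) (r : ℕ)
    (hL : Admissible Pstar lam L) (hL' : Admissible Pstar lam L')
    (hsub : L.ideals ⊆ L'.ideals) (hcard : L'.ideals.card = L.ideals.card + r) :
    chainDim Pstar L' = chainDim Pstar L + r ∧
    (r = 1 → ∃ J ∉ L.ideals, L'.ideals = insert J L.ideals) := by
  have h := hL.chainDim_add_card_image
  have h' := hL'.chainDim_add_card_image
  refine ⟨by omega, ?_⟩
  rintro rfl
  obtain ⟨J, hJ, hins⟩ := (Finset.covBy_iff_exists_insert).1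
    (Finset.covBy_iff_card_sdiff_eq_one.2 ⟨hsub, by rw [Finset.card_sdiff_of_subset hsub]; omega⟩)
  exact ⟨J, hJ, hins.symm⟩
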